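/- Let X and Y be Hermitian d×d complex matrices. Then the expectation over a Haar-random unitary U of (U†XU)·⟨U†XU, Y⟩ equals (1/(d²−1))·(‖X‖_F² − tr(X)²/d)·(Y − tr(Y)I/d) + tr(X)²tr(Y)I/d². -/

import Mathlib

open Matrix MeasureTheory

noncomputable instance matrixMeasurableSpace (d : ℕ) :
    MeasurableSpace (Matrix (Fin d) (Fin d) ℂ) := MeasurableSpace.pi

/-- Hilbert–Schmidt inner product ⟨A,B⟩ = tr(A†B). -/
noncomputable def hsInner {d : ℕ} (A B : Matrix (Fin d) (Fin d) ℂ) : ℂ :=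
  (Aᴴ * B).trace

/-- The coefficients of a unitary conjugate of a matrix unit. -/
lemma conjTranspose_mul_single_mul_apply {n : Type*} [Fintype n] [DecidableEq n]
    (V : Matrix n n ℂ) (a b i j : n) :
    (Vᴴ * single a b (1 : ℂ) * V) i j = star (V a i) * V b j := by
  rw [Matrix.mul_assoc, Matrix.mul_apply, Finset.sum_eq_single a]
  · simp
  · intro k _ hk
    simp [hk]
  · simp

lemma exists_perm_map_pair {n : Type*} [DecidableEq n] {a c b e : n} (hac : a ≠ c) (hbe : b ≠ e) :
    ∃ σ : Equiv.Perm n, σ a = b ∧ σ c = e := by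
  refine ⟨Equiv.swap (Equiv.swap a b c) e * Equiv.swap a b, ?_, by simp⟩
  have : b ≠ Equiv.swap a b c := by
    intro h
    exact hac ((Equiv.swap a b).injective (by rw [Equiv.swap_apply_left, ← h]))
  simp [Equiv.swap_apply_of_ne_of_ne this hbe]

section InvariantForm

variable {n : Type*} [Fintype n] [DecidableEq n]

/-- A bilinear form on square matrices that is invariant under simultaneous unitary
conjugation of both arguments. -/
def IsUnitarilyInvariant (G : Matrix n n ℂ →ₗ[ℂ] Matrix n n ℂ →ₗ[ℂ] ℂ) : Prop :=
  ∀ V ∈ unitaryGroup n ℂ, ∀ A B, G (Vᴴ * A * V) (Vᴴ * B * V) = G A B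

namespace IsUnitarilyInvariant

variable {G : Matrix n n ℂ →ₗ[ℂ] Matrix n n ℂ →ₗ[ℂ] ℂ}

lemma single_perm (hG : IsUnitarilyInvariant G) (σ : Equiv.Perm n) (a b c e : n) :
    G (single (σ a) (σ b) 1) (single (σ c) (σ e) 1) = G (single a b 1) (single c e 1) := by
  have hV : σ.permMatrix ℂ ∈ unitaryGroup n ℂ := by
    rw [mem_unitaryGroup_iff, star_eq_conjTranspose, conjTranspose_permMatrix,
      ← permMatrix_mul, inv_mul_cancel, permMatrix_one]
  have key (x y : n) : (σ.permMatrix ℂ)ᴴ * single x y (1 : ℂ) * σ.permMatrix ℂ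
      = single (σ x) (σ y) 1 := by
    ext i j
    rw [conjTranspose_mul_single_mul_apply]
    by_cases hi : σ x = i <;> by_cases hj : σ y = j <;>
      simp [PEquiv.toMatrix_apply, Equiv.Perm.permMatrix, hi, hj]
  rw [← hG _ hV (single a b 1), key, key]

/-- Invariance under diagonal unitaries kills the unbalanced coefficients. -/
lemma single_eq_zero (hG : IsUnitarilyInvariant G) {a b c e : n}
    (h₁ : ¬(a = b ∧ c = e)) (h₂ : ¬(a = e ∧ b = c)) :
    G (single a b 1) (single c e 1) = 0 := by
  have key (x : n) : (if a = x then -Complex.I else 1) * (if b = x then Complex.I else 1) *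
      ((if c = x then -Complex.I else 1) * (if e = x then Complex.I else 1)) *
        G (single a b 1) (single c e 1) = G (single a b 1) (single c e 1) := by
    let v : n → ℂ := fun y => if y = x then Complex.I else 1
    have hV : diagonal v ∈ unitaryGroup n ℂ := by
      rw [mem_unitaryGroup_iff, star_eq_conjTranspose, diagonal_conjTranspose,
        diagonal_mul_diagonal, ← diagonal_one]
      congr 1
      ext y
      by_cases h : y = x <;> simp [v, h]
    have hs (p q : n) : (diagonal v)ᴴ * single p q (1 : ℂ) * diagonal v
        = ((if p = x then -Complex.I else 1) * (if q = x then Complex.I else 1)) •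
          single p q (1 : ℂ) := by
      ext i j
      rw [conjTranspose_mul_single_mul_apply]
      by_cases hi : p = i <;> by_cases hj : q = j <;> by_cases hpx : p = x <;>
        simp_all [v]
    have := hG _ hV (single a b 1) (single c e 1)
    rw [hs, hs, map_smul, map_smul, LinearMap.smul_apply, smul_eq_mul, smul_eq_mul] at this
    rw [← mul_assoc] at this
    linear_combination this
  by_contra hne
  have key' (x : n) := mul_right_cancel₀ hne ((key x).trans (one_mul _).symm)
  have hI : Complex.I ≠ 1 := fun h => by simpa using congrArg Complex.re h
  have hI' : -Complex.I ≠ 1 := fun h => by simpa using congrArg Complex.re h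
  have hm : (-1 : ℂ) ≠ 1 := by norm_num
  have ha : a = b ∨ a = e := by
    by_contra! h
    have := key' a
    by_cases hca : c = a <;> simp_all [Ne.symm h.1, Ne.symm h.2]
  have hc : c = b ∨ c = e := by
    by_contra! h
    have := key' c
    by_cases hac : a = c <;> simp_all [Ne.symm h.1, Ne.symm h.2]
  have hb : a = b ∨ c = b := by
    by_contra! h
    have := key' b
    by_cases heb : e = b <;> simp_all
  have he : a = e ∨ c = e := by
    by_contra! h
    have := key' e
    by_cases hbe : b = e <;> simp_all
  grind

/-- The diagonal coefficients are determined by the off-diagonal ones, by invariance under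
`(1 + I • S) / √2` where `S` swaps two basis vectors. -/
lemma single_self (hG : IsUnitarilyInvariant G) {a c : n} (hac : a ≠ c) :
    G (single a a 1) (single a a 1)
      = G (single a a 1) (single c c 1) + G (single a c 1) (single c a 1) := by
  set S : Matrix n n ℂ := (Equiv.swap a c).permMatrix ℂ with hS
  have hSS : S * S = 1 := by
    rw [hS, ← permMatrix_mul, Equiv.swap_mul_self, permMatrix_one]
  have hSH : Sᴴ = S := by rw [hS, conjTranspose_permMatrix, Equiv.swap_inv]
  obtain ⟨r, hr, hrs⟩ : ∃ r : ℂ, r * r = 1 / 2 ∧ star r = r := by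
    refine ⟨((√2 : ℝ) : ℂ)⁻¹, ?_, by simp⟩
    rw [← mul_inv, ← Complex.ofReal_mul, Real.mul_self_sqrt (by norm_num)]
    norm_num
  set V : Matrix n n ℂ := r • (1 + Complex.I • S) with hVdef
  have hVH : Vᴴ = r • (1 - Complex.I • S) := by
    simp [hVdef, conjTranspose_smul, hSH, hrs, sub_eq_add_neg]
  have hV : V ∈ unitaryGroup n ℂ := by
    rw [mem_unitaryGroup_iff, star_eq_conjTranspose, hVH, hVdef]
    simp only [smul_mul_smul_comm, hr, mul_sub, add_mul, one_mul, mul_one, hSS, Complex.I_mul_I]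
    module
  have hconj (A : Matrix n n ℂ) : Vᴴ * A * V
      = (1 / 2 : ℂ) • (A + S * A * S + Complex.I • (A * S - S * A)) := by
    rw [hVH, hVdef, smul_mul_assoc, smul_mul_smul_comm, hr]
    simp only [smul_mul_assoc, mul_smul_comm, smul_sub, smul_smul, mul_add, sub_mul, one_mul,
      mul_one, Complex.I_mul_I]
    module
  have hAS (x : n) : single x a (1 : ℂ) * S = single x c 1 := by
    rw [hS]
    ext i j
    by_cases hi : x = i
    · subst hi
      simp [single_apply, PEquiv.toMatrix_apply, Equiv.Perm.permMatrix]
    · simp [hi, Ne.symm hi]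
  have hSA : S * single a a (1 : ℂ) = single c a 1 := by
    have := congrArg conjTranspose (hAS a)
    simpa [conjTranspose_mul, hSH, conjTranspose_single] using this
  have hSAS : S * single a a (1 : ℂ) * S = single c c 1 := by
    rw [hSA, hAS]
  have h := hG V hV (single a a 1) (single a a 1)
  rw [hconj, hSAS, hAS, hSA] at h
  have p₁ := hG.single_perm (Equiv.swap a c) a a a a
  have p₂ := hG.single_perm (Equiv.swap a c) a a c c
  have p₃ := hG.single_perm (Equiv.swap a c) a c c a
  simp only [Equiv.swap_apply_left, Equiv.swap_apply_right] at p₁ p₂ p₃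
  have z {x y z w : n} (h₁ : ¬(x = y ∧ z = w)) (h₂ : ¬(x = w ∧ y = z)) :=
    hG.single_eq_zero h₁ h₂
  have hca := hac.symm
  simp only [map_smul, map_add, map_sub, LinearMap.smul_apply, LinearMap.add_apply,
    LinearMap.sub_apply, smul_eq_mul, p₁, p₂, p₃,
    z (x := a) (y := a) (z := a) (w := c) (by simp [hac]) (by simp [hac]),
    z (x := a) (y := a) (z := c) (w := a) (by simp [hca]) (by simp [hac]),
    z (x := c) (y := c) (z := a) (w := c) (by simp [hac]) (by simp [hca]),
    z (x := c) (y := c) (z := c) (w := a) (by simp [hca]) (by simp [hca]),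
    z (x := a) (y := c) (z := a) (w := a) (by simp [hac]) (by simp [hca]),
    z (x := a) (y := c) (z := c) (w := c) (by simp [hac]) (by simp [hac]),
    z (x := c) (y := a) (z := a) (w := a) (by simp [hca]) (by simp [hca]),
    z (x := c) (y := a) (z := c) (w := c) (by simp [hca]) (by simp [hac]),
    z (x := a) (y := c) (z := a) (w := c) (by simp [hac]) (by simp [hca]),
    z (x := c) (y := a) (z := c) (w := a) (by simp [hca]) (by simp [hac])] at h
  have hI : Complex.I * Complex.I = -1 := Complex.I_mul_I
  linear_combination (-2) * h - (G (single a c 1) (single c a 1)) * hI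

/-- Unitarily invariant bilinear forms on matrices are combinations of `tr A * tr B`
and `tr (A * B)`. -/
theorem exists_eq_trace (hG : IsUnitarilyInvariant G) :
    ∃ α β : ℂ, ∀ A B, G A B = α * (A.trace * B.trace) + β * (A * B).trace := by
  rcases subsingleton_or_nontrivial n with hn | hn
  · have h (A : Matrix n n ℂ) : A = A.trace • (1 : Matrix n n ℂ) := by
      ext i j
      obtain rfl := Subsingleton.elim i j
      simp [trace, Fintype.sum_subsingleton _ i]
    refine ⟨G 1 1, 0, fun A B => ?_⟩
    conv_lhs => rw [h A, h B]
    simp only [map_smul, LinearMap.smul_apply, smul_eq_mul]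
    ring
  obtain ⟨a₀, c₀, h₀⟩ := exists_pair_ne n
  set α := G (single a₀ a₀ 1) (single c₀ c₀ 1)
  set β := G (single a₀ c₀ 1) (single c₀ a₀ 1)
  have hα' {a c : n} (h : a ≠ c) : G (single a a 1) (single c c 1) = α := by
    obtain ⟨σ, rfl, rfl⟩ := exists_perm_map_pair h₀ h
    exact hG.single_perm σ _ _ _ _
  have hβ' {a c : n} (h : a ≠ c) : G (single a c 1) (single c a 1) = β := by
    obtain ⟨σ, rfl, rfl⟩ := exists_perm_map_pair h₀ h
    exact hG.single_perm σ _ _ _ _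
  have hunit (a b c e : n) : G (single a b 1) (single c e 1)
      = α * (if a = b ∧ c = e then 1 else 0) + β * (if a = e ∧ b = c then 1 else 0) := by
    by_cases h₁ : a = b ∧ c = e
    · obtain ⟨rfl, rfl⟩ := h₁
      by_cases h : a = c
      · subst h
        obtain ⟨x, hx⟩ := exists_ne a
        rw [hG.single_self hx.symm, hα' hx.symm, hβ' hx.symm]
        simp
      · simp [hα' h, h]
    · by_cases h₂ : a = e ∧ b = c
      · obtain ⟨rfl, rfl⟩ := h₂
        have h : a ≠ b := fun h => h₁ ⟨h, h.symm⟩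
        simp [hβ' h, h]
      · simp [hG.single_eq_zero h₁ h₂, h₁, h₂]
  refine ⟨α, β, fun A B => ?_⟩
  have hsum (A : Matrix n n ℂ) : A = ∑ i, ∑ j, A i j • single i j (1 : ℂ) := by
    conv_lhs => rw [matrix_eq_sum_single A]
    simp [smul_single]
  conv_lhs => rw [hsum A, hsum B]
  simp only [map_sum, map_smul, LinearMap.sum_apply, LinearMap.smul_apply, smul_eq_mul, hunit]
  have h₁ : A.trace * B.trace
      = ∑ c, ∑ e, ∑ a, ∑ b, B c e * (A a b * if a = b ∧ c = e then 1 else 0) := by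
    simp only [trace, diag_apply, Finset.sum_mul_sum, ite_and]
    rw [Finset.sum_comm]
    simp [mul_comm]
  have h₂ : (A * B).trace
      = ∑ c, ∑ e, ∑ a, ∑ b, B c e * (A a b * if a = e ∧ b = c then 1 else 0) := by
    rw [trace_mul_comm]
    simp [trace, Matrix.mul_apply, ite_and]
  rw [h₁, h₂]
  simp only [Finset.mul_sum, ← Finset.sum_add_distrib]
  refine Finset.sum_congr rfl fun c _ => Finset.sum_congr rfl fun e _ =>
    Finset.sum_congr rfl fun a _ => Finset.sum_congr rfl fun b _ => ?_
  ring

end IsUnitarilyInvariant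

end InvariantForm

instance matrixBorelSpace (d : ℕ) : BorelSpace (Matrix (Fin d) (Fin d) ℂ) :=
  inferInstanceAs (BorelSpace (Fin d → Fin d → ℂ))

instance unitaryGroupCompactSpace {n : Type*} [Fintype n] [DecidableEq n] :
    CompactSpace (unitaryGroup n ℂ) := by
  refine isCompact_iff_compactSpace.mp ?_
  refine IsCompact.of_isClosed_subset
    (isCompact_univ_pi fun _ : n => isCompact_univ_pi fun _ : n =>
      isCompact_closedBall (0 : ℂ) 1) ?_ ?_
  · have : ((unitaryGroup n ℂ : Submonoid (Matrix n n ℂ)) : Set (Matrix n n ℂ))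
        = {A | A * star A = 1} := by
      ext A
      exact mem_unitaryGroup_iff
    rw [this]
    exact isClosed_eq (by fun_prop) continuous_const
  · intro A hA i _ j _
    simpa using entry_norm_bound_of_unitary hA i j

section Haar

variable {d : ℕ} (μ : Measure (unitaryGroup (Fin d) ℂ)) [IsProbabilityMeasure μ]

lemma integrable_of_continuous_unitaryGroup {f : unitaryGroup (Fin d) ℂ → ℂ}
    (hf : Continuous f) : Integrable f μ :=
  hf.integrable_of_hasCompactSupport (HasCompactSupport.of_compactSpace f)

/-- The bilinear form `(A, B) ↦ E[tr(U†AU Y) (U†BU)ᵢⱼ]`. -/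
noncomputable def conjMomentForm (Y : Matrix (Fin d) (Fin d) ℂ) (i j : Fin d) :
    Matrix (Fin d) (Fin d) ℂ →ₗ[ℂ] Matrix (Fin d) (Fin d) ℂ →ₗ[ℂ] ℂ :=
  LinearMap.mk₂ ℂ
    (fun A B => ∫ U : unitaryGroup (Fin d) ℂ,
      ((U : Matrix (Fin d) (Fin d) ℂ)ᴴ * A * (U : Matrix (Fin d) (Fin d) ℂ) * Y).trace *
        ((U : Matrix (Fin d) (Fin d) ℂ)ᴴ * B * (U : Matrix (Fin d) (Fin d) ℂ)) i j ∂μ)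
    (fun A A' B => by
      rw [← integral_add (integrable_of_continuous_unitaryGroup μ (by fun_prop))
        (integrable_of_continuous_unitaryGroup μ (by fun_prop))]
      simp only [Matrix.mul_add, trace_add, add_mul])
    (fun c A B => by
      rw [smul_eq_mul, ← integral_const_mul]
      simp only [Matrix.mul_smul, Matrix.smul_mul, trace_smul, smul_eq_mul, mul_assoc])
    (fun A B B' => by
      rw [← integral_add (integrable_of_continuous_unitaryGroup μ (by fun_prop))
        (integrable_of_continuous_unitaryGroup μ (by fun_prop))]
      simp only [Matrix.add_mul, Matrix.add_apply, mul_add])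
    (fun c A B => by
      rw [smul_eq_mul, ← integral_const_mul]
      simp only [Matrix.mul_smul, Matrix.smul_mul, Matrix.smul_apply, smul_eq_mul,
        mul_left_comm c])

variable {μ}

lemma isUnitarilyInvariant_conjMomentForm
    (hinv : ∀ V : unitaryGroup (Fin d) ℂ, Measure.map (fun U => V * U) μ = μ)
    (Y : Matrix (Fin d) (Fin d) ℂ) (i j : Fin d) :
    IsUnitarilyInvariant (conjMomentForm μ Y i j) := by
  intro V hV A B
  simp only [conjMomentForm, LinearMap.mk₂_apply]
  conv_rhs => rw [← hinv ⟨V, hV⟩]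
  rw [integral_map (by fun_prop) (Continuous.aestronglyMeasurable (by fun_prop))]
  simp only [Submonoid.coe_mul, conjTranspose_mul, Matrix.mul_assoc]

lemma conjMomentForm_one_one (Y : Matrix (Fin d) (Fin d) ℂ) (i j : Fin d) :
    conjMomentForm μ Y i j 1 1 = Y.trace * (1 : Matrix (Fin d) (Fin d) ℂ) i j := by
  have h (U : unitaryGroup (Fin d) ℂ) :
      (U : Matrix (Fin d) (Fin d) ℂ)ᴴ * (U : Matrix (Fin d) (Fin d) ℂ) = 1 :=
    mem_unitaryGroup_iff'.mp U.2
  simp [conjMomentForm, LinearMap.mk₂_apply, h]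

lemma sum_conjMomentForm_single (Y : Matrix (Fin d) (Fin d) ℂ) (i j : Fin d) :
    ∑ a, ∑ c, conjMomentForm μ Y i j (single a c 1) (single c a 1) = Y i j := by
  have h (U : unitaryGroup (Fin d) ℂ) :
      (U : Matrix (Fin d) (Fin d) ℂ)ᴴ * (U : Matrix (Fin d) (Fin d) ℂ) = 1 :=
    mem_unitaryGroup_iff'.mp U.2
  have ht (U : Matrix (Fin d) (Fin d) ℂ) (a c : Fin d) :
      (Uᴴ * single a c (1 : ℂ) * U * Y).trace = (U * Y * Uᴴ) c a := by
    rw [Matrix.mul_assoc, Matrix.mul_assoc, trace_mul_comm, Matrix.mul_assoc, trace_single_mul]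
    simp [Matrix.mul_assoc]
  have hp (U : unitaryGroup (Fin d) ℂ) : ∑ a, ∑ c,
      ((U : Matrix (Fin d) (Fin d) ℂ)ᴴ * single a c (1 : ℂ) * (U : Matrix (Fin d) (Fin d) ℂ)
          * Y).trace *
        ((U : Matrix (Fin d) (Fin d) ℂ)ᴴ * single c a (1 : ℂ) *
          (U : Matrix (Fin d) (Fin d) ℂ)) i j = Y i j := by
    have : (U : Matrix (Fin d) (Fin d) ℂ)ᴴ * ((U : Matrix (Fin d) (Fin d) ℂ) * Y *
        (U : Matrix (Fin d) (Fin d) ℂ)ᴴ) * (U : Matrix (Fin d) (Fin d) ℂ) = Y := by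
      rw [Matrix.mul_assoc _ Y, ← Matrix.mul_assoc, h, Matrix.one_mul, Matrix.mul_assoc, h,
        Matrix.mul_one]
    conv_rhs => rw [← this, Matrix.mul_apply]
    refine Finset.sum_congr rfl fun a _ => ?_
    rw [Matrix.mul_apply, Finset.sum_mul]
    refine Finset.sum_congr rfl fun c _ => ?_
    rw [ht, conjTranspose_mul_single_mul_apply, conjTranspose_apply]
    ring
  simp only [conjMomentForm, LinearMap.mk₂_apply]
  have hint (a c : Fin d) := integrable_of_continuous_unitaryGroup μ
    (f := fun U => ((U : Matrix (Fin d) (Fin d) ℂ)ᴴ * single a c (1 : ℂ) *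
        (U : Matrix (Fin d) (Fin d) ℂ) * Y).trace *
      ((U : Matrix (Fin d) (Fin d) ℂ)ᴴ * single c a (1 : ℂ) *
        (U : Matrix (Fin d) (Fin d) ℂ)) i j) (by fun_prop)
  simp_rw [← integral_finsetSum Finset.univ fun c _ => hint _ c]
  rw [← integral_finsetSum Finset.univ
    fun a _ => integrable_finsetSum Finset.univ fun c _ => hint a c]
  simp [hp]

end Haar

/-- For Hermitian `X, Y` and `μ` the Haar (i.e. left-invariant)
probability measure on the unitary group `U(d)`,
`E_U[(U†XU)·⟨U†XU, Y⟩] = (1/(d²−1))·(‖X‖_F² − tr(X)²/d)·(Y − tr(Y)I/d) + tr(X)²tr(Y)I/d²`,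
stated entrywise (note `‖X‖_F² = tr(XᴴX)`). -/
theorem haar_second_moment_identity {d : ℕ}
    (X Y : Matrix (Fin d) (Fin d) ℂ) (hX : X.IsHermitian) (hY : Y.IsHermitian)
    (μ : Measure (Matrix.unitaryGroup (Fin d) ℂ)) [IsProbabilityMeasure μ]
    (hinv : ∀ V : Matrix.unitaryGroup (Fin d) ℂ,
      Measure.map (fun U => V * U) μ = μ) :
    ∀ i j : Fin d,
      (∫ U : Matrix.unitaryGroup (Fin d) ℂ,
        hsInner ((U : Matrix (Fin d) (Fin d) ℂ)ᴴ * X * (U : Matrix (Fin d) (Fin d) ℂ)) Y *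
          (((U : Matrix (Fin d) (Fin d) ℂ)ᴴ * X * (U : Matrix (Fin d) (Fin d) ℂ)) i j) ∂μ) =
      (1 / ((d : ℂ) ^ 2 - 1)) * ((Xᴴ * X).trace - X.trace ^ 2 / d) *
          ((Y - (Y.trace / d) • (1 : Matrix (Fin d) (Fin d) ℂ)) i j) +
        X.trace ^ 2 * Y.trace / (d : ℂ) ^ 2 * ((1 : Matrix (Fin d) (Fin d) ℂ) i j) := by
  intro i j
  obtain ⟨α, β, hαβ⟩ := (isUnitarilyInvariant_conjMomentForm hinv Y i j).exists_eq_trace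
  have h₁ := conjMomentForm_one_one (μ := μ) Y i j
  have h₂ := sum_conjMomentForm_single (μ := μ) Y i j
  simp only [hαβ] at h₁ h₂
  have hlhs : (∫ U : Matrix.unitaryGroup (Fin d) ℂ,
        hsInner ((U : Matrix (Fin d) (Fin d) ℂ)ᴴ * X * (U : Matrix (Fin d) (Fin d) ℂ)) Y *
          (((U : Matrix (Fin d) (Fin d) ℂ)ᴴ * X * (U : Matrix (Fin d) (Fin d) ℂ)) i j) ∂μ)
      = conjMomentForm μ Y i j X X := by
    simp [conjMomentForm, hsInner, hX.eq, Matrix.mul_assoc]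
  rw [hlhs, hαβ, hX.eq]
  have e₁ : ∑ a : Fin d, ∑ c : Fin d,
      (α * ((single a c (1 : ℂ)).trace * (single c a (1 : ℂ)).trace)
        + β * (single a c (1 : ℂ) * single c a 1).trace) = α * d + β * d ^ 2 := by
    have ht (a c : Fin d) : (single a c (1 : ℂ)).trace = if a = c then 1 else 0 := by
      by_cases h : a = c
      · subst h
        simp
      · simp [h]
    simp [ht, Finset.sum_add_distrib]
    ring
  rw [e₁] at h₂
  simp only [Matrix.one_mul, trace_one, Fintype.card_fin] at h₁
  have hd : d ≠ 0 := by rintro rfl; exact i.elim0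
  have hd' : (d : ℂ) ≠ 0 := by exact_mod_cast hd
  by_cases hd1 : d = 1
  · subst hd1
    simp [trace, Subsingleton.elim i 0, Subsingleton.elim j 0, Matrix.mul_apply] at h₁ ⊢
    linear_combination (X 0 0) ^ 2 * h₁
  have hd2 : (d : ℂ) ^ 2 - 1 ≠ 0 := by
    rw [sub_ne_zero]
    norm_cast
    simpa using hd1
  simp only [Matrix.sub_apply, Matrix.smul_apply, smul_eq_mul]
  rw [← h₂]
  set δ := (1 : Matrix (Fin d) (Fin d) ℂ) i j
  field_simp
  linear_combination (X.trace ^ 2 * (d : ℂ) ^ 2 - (X * X).trace * d) * h₁
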